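/- arXiv:1412.5736 — 2 statements merged into one kernel-verified Lean document; each statement's English description precedes it below -/
import Mathlib

section
/- Let ρ : 𝔽 → ℝ be a sublinear operator that is continuous from above, and let E : 𝔽 → ℝ be a linear functional dominated by ρ, i.e. E(ξ) ≤ ρ(ξ) for all ξ ∈ 𝔽. Then the set function P(A) := E(1_A) for A ∈ 𝒻 is a probability measure: P(A) ≥ 0 for all A ∈ 𝒻, P(Ω) = 1, and P is countably additive (for any sequence of pairwise disjoint measurable sets A_n, P(⋃_n A_n) = ∑_n P(A_n)). -/
open MeasureTheory Filter

/-- A bounded measurable real-valued function (an element of 𝔽). -/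
def BddMeas {Ω : Type*} [MeasurableSpace Ω] (ξ : Ω → ℝ) : Prop :=
  Measurable ξ ∧ ∃ M : ℝ, ∀ ω, |ξ ω| ≤ M

/-- A sublinear operator on the bounded measurable functions. -/
structure IsSublinearOp {Ω : Type*} [MeasurableSpace Ω] (ρ : (Ω → ℝ) → ℝ) : Prop where
  mono : ∀ ⦃ξ₁ ξ₂ : Ω → ℝ⦄, BddMeas ξ₁ → BddMeas ξ₂ → (∀ ω, ξ₂ ω ≤ ξ₁ ω) → ρ ξ₂ ≤ ρ ξ₁
  const : ∀ c : ℝ, ρ (fun _ => c) = c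
  subadd : ∀ ⦃ξ₁ ξ₂ : Ω → ℝ⦄, BddMeas ξ₁ → BddMeas ξ₂ →
    ρ (fun ω => ξ₁ ω + ξ₂ ω) ≤ ρ ξ₁ + ρ ξ₂
  poshom : ∀ ⦃ξ : Ω → ℝ⦄, BddMeas ξ → ∀ l : ℝ, 0 ≤ l → ρ (fun ω => l * ξ ω) = l * ρ ξ

/-- Continuity from above: ρ(ξₙ) ↓ 0 whenever ξₙ ↓ 0 pointwise. -/
def ContFromAbove {Ω : Type*} [MeasurableSpace Ω] (ρ : (Ω → ℝ) → ℝ) : Prop :=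
  ∀ ξ : ℕ → Ω → ℝ, (∀ n, BddMeas (ξ n)) → (∀ ω, Antitone fun n => ξ n ω) →
    (∀ ω, Tendsto (fun n => ξ n ω) atTop (nhds 0)) →
    Tendsto (fun n => ρ (ξ n)) atTop (nhds 0)

theorem bddMeas_indicator_one {Ω : Type*} [MeasurableSpace Ω] {A : Set Ω}
    (hA : MeasurableSet A) : BddMeas (A.indicator fun _ => (1 : ℝ)) := by
  refine ⟨measurable_const.indicator hA, 1, fun ω => ?_⟩
  by_cases h : ω ∈ A <;> simp [h]

theorem bddMeas_const {Ω : Type*} [MeasurableSpace Ω] (c : ℝ) :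
    BddMeas (fun _ : Ω => c) :=
  ⟨measurable_const, |c|, fun _ => le_rfl⟩

theorem BddMeas.const_mul {Ω : Type*} [MeasurableSpace Ω] {ξ : Ω → ℝ} (hξ : BddMeas ξ)
    (c : ℝ) : BddMeas (fun ω => c * ξ ω) := by
  obtain ⟨hm, M, hM⟩ := hξ
  refine ⟨hm.const_mul c, |c| * M, fun ω => ?_⟩
  rw [abs_mul]
  exact mul_le_mul_of_nonneg_left (hM ω) (abs_nonneg c)

/-- The tails of a sequence of pairwise disjoint sets have empty intersection. -/
theorem iInter_iUnion_ge_eq_empty {Ω : Type*} {A : ℕ → Set Ω}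
    (hd : Pairwise (Function.onFun Disjoint A)) : ⋂ n, ⋃ i ≥ n, A i = ∅ := by
  refine Set.eq_empty_of_forall_notMem fun ω hω => ?_
  simp only [Set.mem_iInter, Set.mem_iUnion] at hω
  obtain ⟨i, -, hi⟩ := hω 0
  obtain ⟨j, hij, hj⟩ := hω (i + 1)
  exact Set.disjoint_left.1 (hd (show i ≠ j by omega)) hi hj

theorem antitone_iUnion_ge {Ω : Type*} (A : ℕ → Set Ω) : Antitone fun n => ⋃ i ≥ n, A i :=
  fun _ _ hmn => Set.biUnion_subset_biUnion_left fun _ hi => le_trans hmn hi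

theorem iUnion_ge_eq_union {Ω : Type*} (A : ℕ → Set Ω) (n : ℕ) :
    ⋃ i ≥ n, A i = A n ∪ ⋃ i ≥ n + 1, A i := by
  ext ω
  simp only [Set.mem_iUnion, Set.mem_union, exists_prop]
  constructor
  · rintro ⟨i, hi, h⟩
    obtain rfl | hlt := eq_or_lt_of_le hi
    · exact Or.inl h
    · exact Or.inr ⟨i, hlt, h⟩
  · rintro (h | ⟨i, hi, h⟩)
    · exact ⟨n, le_rfl, h⟩
    · exact ⟨i, (Nat.le_succ n).trans hi, h⟩

/-- any linear functional dominated by a sublinear operator continuous from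
above induces (via indicators) a probability measure. -/
theorem stmt_1 {Ω : Type*} [MeasurableSpace Ω]
    (ρ : (Ω → ℝ) → ℝ) (hsub : IsSublinearOp ρ) (hcont : ContFromAbove ρ)
    (E : (Ω → ℝ) → ℝ)
    (hadd : ∀ ξ₁ ξ₂ : Ω → ℝ, BddMeas ξ₁ → BddMeas ξ₂ →
      E (fun ω => ξ₁ ω + ξ₂ ω) = E ξ₁ + E ξ₂)
    (hsmul : ∀ (c : ℝ) (ξ : Ω → ℝ), BddMeas ξ → E (fun ω => c * ξ ω) = c * E ξ)
    (hdom : ∀ ξ : Ω → ℝ, BddMeas ξ → E ξ ≤ ρ ξ) :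
    (∀ A : Set Ω, MeasurableSet A → 0 ≤ E (A.indicator fun _ => (1 : ℝ))) ∧
    E (Set.univ.indicator fun _ => (1 : ℝ)) = 1 ∧
    (∀ A : ℕ → Set Ω, (∀ n, MeasurableSet (A n)) → Pairwise (Function.onFun Disjoint A) →
      HasSum (fun n => E ((A n).indicator fun _ => (1 : ℝ)))
        (E ((⋃ n, A n).indicator fun _ => (1 : ℝ)))) := by
  have hneg : ∀ ξ : Ω → ℝ, BddMeas ξ → (∀ ω, 0 ≤ ξ ω) → 0 ≤ E ξ := fun ξ hξ h0 => by
    have h₁ := hdom _ (hξ.const_mul (-1))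
    have h₂ := hsub.mono (bddMeas_const 0) (hξ.const_mul (-1)) fun ω => by linarith [h0 ω]
    rw [hsmul _ _ hξ] at h₁
    rw [hsub.const] at h₂
    linarith
  have hnonneg : ∀ A : Set Ω, MeasurableSet A → 0 ≤ E (A.indicator fun _ => (1 : ℝ)) :=
    fun A hA => hneg _ (bddMeas_indicator_one hA)
      (Set.indicator_nonneg fun _ _ => zero_le_one)
  refine ⟨hnonneg, ?_, fun A hA hd => ?_⟩
  · rw [Set.indicator_univ]
    have h₁ := hdom _ (bddMeas_const 1)
    have h₂ := hdom _ ((bddMeas_const (Ω := Ω) 1).const_mul (-1))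
    rw [hsmul _ _ (bddMeas_const 1), hsub.const] at h₂
    rw [hsub.const] at h₁
    linarith
  · have hT : ∀ n, MeasurableSet (⋃ i ≥ n, A i) := fun n =>
      MeasurableSet.iUnion fun i => MeasurableSet.iUnion fun _ => hA i
    have hsum : ∀ n, ∑ i ∈ Finset.range n, E ((A i).indicator fun _ => (1 : ℝ)) =
        E ((⋃ i, A i).indicator fun _ => (1 : ℝ)) -
          E ((⋃ i ≥ n, A i).indicator fun _ => (1 : ℝ)) := by
      intro n
      induction n with
      | zero => simp
      | succ n ih =>
        have hdisj : Disjoint (A n) (⋃ i ≥ n + 1, A i) := by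
          simp only [Set.disjoint_iUnion_right]
          exact fun i hi => hd (show n ≠ i by omega)
        have hstep := hadd _ _ (bddMeas_indicator_one (hA n)) (bddMeas_indicator_one (hT (n + 1)))
        rw [← Set.indicator_union_of_disjoint hdisj, ← iUnion_ge_eq_union] at hstep
        rw [Finset.sum_range_succ, ih, hstep]
        ring
    have htail : Tendsto (fun n => E ((⋃ i ≥ n, A i).indicator fun _ => (1 : ℝ))) atTop
        (nhds 0) := by
      refine squeeze_zero (fun n => hnonneg _ (hT n))
        (fun n => hdom _ (bddMeas_indicator_one (hT n)))
        (hcont _ (fun n => bddMeas_indicator_one (hT n)) (fun ω m n hmn => ?_) fun ω => ?_)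
      · exact Set.indicator_le_indicator_of_subset (antitone_iUnion_ge A hmn)
          (fun _ => zero_le_one) ω
      · have h := Antitone.tendsto_indicator _ (antitone_iUnion_ge A) (fun _ => (1 : ℝ)) ω
        rw [iInter_iUnion_ge_eq_empty hd, Set.indicator_empty] at h
        exact h.mono_right (pure_le_nhds 0)
    rw [hasSum_iff_tendsto_nat_of_nonneg fun n => hnonneg _ (hA n)]
    simp only [hsum]
    simpa using tendsto_const_nhds.sub htail
end

section
/- Let P₀ be a probability measure on (Ω, 𝒻) and 𝒫 a nonempty family of probability measures, each absolutely continuous with respect to P₀, such that the set of Radon–Nikodym densities {dP/dP₀ : P ∈ 𝒫}, viewed as a subset of L¹(Ω, 𝒻, P₀), is compact in the weak topology σ(L¹(P₀), L∞(P₀)). Then the sublinear operator ρ(ξ) := sup_{P∈𝒫} E_P[ξ] is continuous from above: if ξ_n ∈ 𝔽 and ξ_n(ω) ↓ 0 for every ω ∈ Ω, then ρ(ξ_n) ↓ 0. -/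
open MeasureTheory Filter

lemma BddMeas.memLp_top {Ω : Type*} [MeasurableSpace Ω] {ξ : Ω → ℝ} (hξ : BddMeas ξ)
    (μ : Measure Ω) : MemLp ξ ⊤ μ := by
  obtain ⟨hm, M, hM⟩ := hξ
  exact memLp_top_of_bound hm.aestronglyMeasurable M (ae_of_all _ hM)

lemma BddMeas.integrable {Ω : Type*} [MeasurableSpace Ω] {ξ : Ω → ℝ} (hξ : BddMeas ξ)
    (μ : Measure Ω) [IsFiniteMeasure μ] : Integrable ξ μ :=
  (hξ.memLp_top μ).integrable le_top

/-- Integration against a bounded measurable function is weakly continuous on `L¹`. -/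
lemma BddMeas.continuous_weakSpace_integral {Ω : Type*} [MeasurableSpace Ω] {ξ : Ω → ℝ}
    (hξ : BddMeas ξ) (μ : Measure Ω) :
    Continuous fun f : WeakSpace ℝ (Lp ℝ 1 μ) =>
      ∫ ω, ξ ω * (toWeakSpace ℝ (Lp ℝ 1 μ)).symm f ω ∂μ := by
  let L : StrongDual ℝ (Lp ℝ 1 μ) :=
    (ContinuousLinearMap.mul ℝ ℝ).lpPairing μ ⊤ 1 ((hξ.memLp_top μ).toLp ξ)
  have hL : Continuous fun f : WeakSpace ℝ (Lp ℝ 1 μ) =>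
      L ((toWeakSpace ℝ (Lp ℝ 1 μ)).symm f) :=
    WeakBilin.eval_continuous (topDualPairing ℝ (Lp ℝ 1 μ)).flip L
  refine hL.congr fun f => ?_
  rw [ContinuousLinearMap.lpPairing_eq_integral]
  refine integral_congr_ae ?_
  filter_upwards [(hξ.memLp_top μ).coeFn_toLp] with ω hω
  simp [hω]

/-- Along a sequence of bounded measurable functions decreasing to `0`, the expectations tend
to `0` uniformly over a family of probability measures with weakly compact set of densities. -/
lemma tendstoUniformlyOn_integral_of_isCompact_densities {Ω : Type*} [MeasurableSpace Ω]
    (P₀ : Measure Ω) [IsProbabilityMeasure P₀]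
    (𝔓 : Set (Measure Ω))
    (hprob : ∀ P ∈ 𝔓, IsProbabilityMeasure P)
    (hac : ∀ P ∈ 𝔓, P ≪ P₀)
    (D : Set (Lp ℝ 1 P₀))
    (hD : ∀ f : Lp ℝ 1 P₀,
      f ∈ D ↔ ∃ P ∈ 𝔓, (f : Ω → ℝ) =ᵐ[P₀] fun ω => (P.rnDeriv P₀ ω).toReal)
    (hcpt : IsCompact (toWeakSpace ℝ (Lp ℝ 1 P₀) '' D))
    (ξ : ℕ → Ω → ℝ) (hbm : ∀ n, BddMeas (ξ n))
    (hanti : ∀ ω, Antitone fun n => ξ n ω)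
    (hto0 : ∀ ω, Tendsto (fun n => ξ n ω) atTop (nhds 0)) :
    TendstoUniformlyOn (fun n P => ∫ ω, ξ n ω ∂P) (fun _ => 0) atTop 𝔓 := by
  have hint : ∀ P ∈ 𝔓, ∀ f : Lp ℝ 1 P₀,
      (f : Ω → ℝ) =ᵐ[P₀] (fun ω => (P.rnDeriv P₀ ω).toReal) →
      ∀ n, ∫ ω, ξ n ω * f ω ∂P₀ = ∫ ω, ξ n ω ∂P := by
    intro P hP f hf n
    have := hprob P hP
    rw [← integral_rnDeriv_smul (hac P hP)]
    refine integral_congr_ae ?_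
    filter_upwards [hf] with ω hω
    rw [hω, smul_eq_mul, mul_comm]
  have hunif : TendstoUniformlyOn
      (fun n f => ∫ ω, ξ n ω * (toWeakSpace ℝ (Lp ℝ 1 P₀)).symm f ω ∂P₀) (fun _ => 0) atTop
      (toWeakSpace ℝ (Lp ℝ 1 P₀) '' D) := by
    refine Antitone.tendstoUniformlyOn_of_forall_tendsto hcpt
      (fun n => ((hbm n).continuous_weakSpace_integral P₀).continuousOn) ?_
      continuousOn_const ?_ <;>
    · rintro _ ⟨f, hf, rfl⟩
      obtain ⟨P, hP, hfP⟩ := (hD f).1 hf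
      have := hprob P hP
      have hi := fun n => (hbm n).integrable P
      simp only [LinearEquiv.symm_apply_apply, hint P hP f hfP]
      first
        | exact fun m n hmn => integral_mono (hi n) (hi m) fun ω => hanti ω hmn
        | simpa using integral_tendsto_of_tendsto_of_antitone hi (integrable_zero Ω ℝ P)
            (ae_of_all P hanti) (ae_of_all P hto0)
  rw [Metric.tendstoUniformlyOn_iff] at hunif ⊢
  intro ε hε
  filter_upwards [hunif ε hε] with n hn P hP
  have := hprob P hP
  have hdens : Integrable (fun ω => (P.rnDeriv P₀ ω).toReal) P₀ :=
    Measure.integrable_toReal_rnDeriv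
  have hf := hdens.coeFn_toL1
  have h := hn _ ⟨hdens.toL1 _, (hD _).2 ⟨P, hP, hf⟩, rfl⟩
  rwa [LinearEquiv.symm_apply_apply, hint P hP _ hf] at h

/-- if the densities of the representing family form a
σ(L¹,L∞)-compact set, then ρ(ξ) = sup_{P∈𝔓} E_P[ξ] is continuous from above. -/
theorem stmt_2 {Ω : Type*} [MeasurableSpace Ω]
    (P₀ : Measure Ω) [IsProbabilityMeasure P₀]
    (𝔓 : Set (Measure Ω)) (h𝔓 : 𝔓.Nonempty)
    (hprob : ∀ P ∈ 𝔓, IsProbabilityMeasure P)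
    (hac : ∀ P ∈ 𝔓, P ≪ P₀)
    (D : Set (Lp ℝ 1 P₀))
    (hD : ∀ f : Lp ℝ 1 P₀,
      f ∈ D ↔ ∃ P ∈ 𝔓, (f : Ω → ℝ) =ᵐ[P₀] fun ω => (P.rnDeriv P₀ ω).toReal)
    (hcpt : IsCompact (toWeakSpace ℝ (Lp ℝ 1 P₀) '' D))
    (ρ : (Ω → ℝ) → ℝ)
    (hρ : ∀ ξ : Ω → ℝ, BddMeas ξ → ρ ξ = ⨆ P ∈ 𝔓, ∫ ω, ξ ω ∂P)
    (ξ : ℕ → Ω → ℝ) (hbm : ∀ n, BddMeas (ξ n))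
    (hanti : ∀ ω, Antitone fun n => ξ n ω)
    (hto0 : ∀ ω, Tendsto (fun n => ξ n ω) atTop (nhds 0)) :
    Antitone (fun n => ρ (ξ n)) ∧ Tendsto (fun n => ρ (ξ n)) atTop (nhds 0) := by
  have hnonneg : ∀ n ω, 0 ≤ ξ n ω := fun n ω => (hanti ω).le_of_tendsto (hto0 ω) n
  have hE0 : ∀ n P, 0 ≤ ∫ ω, ξ n ω ∂P := fun n P => integral_nonneg (hnonneg n)
  have hbdd : ∀ n, BddAbove (Set.range fun P : Measure Ω => ⨆ _ : P ∈ 𝔓, ∫ ω, ξ n ω ∂P) := by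
    intro n
    obtain ⟨-, M, hM⟩ := hbm n
    refine ⟨max M 0, ?_⟩
    rintro _ ⟨P, rfl⟩
    refine Real.iSup_le (fun hP => le_max_of_le_left ?_) (le_max_right _ _)
    have := hprob P hP
    simpa using integral_mono ((hbm n).integrable P) (integrable_const M)
      fun ω => (le_abs_self _).trans (hM ω)
  have hle : ∀ n, ∀ P ∈ 𝔓, ∫ ω, ξ n ω ∂P ≤ ρ (ξ n) := by
    intro n P hP
    rw [hρ _ (hbm n)]
    simpa [hP] using le_ciSup (hbdd n) P
  have hρle : ∀ n c, 0 ≤ c → (∀ P ∈ 𝔓, ∫ ω, ξ n ω ∂P ≤ c) → ρ (ξ n) ≤ c := by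
    intro n c hc h
    rw [hρ _ (hbm n)]
    exact Real.iSup_le (fun P => Real.iSup_le (h P) hc) hc
  have hρ0 : ∀ n, 0 ≤ ρ (ξ n) := by
    obtain ⟨P, hP⟩ := h𝔓
    exact fun n => (hE0 n P).trans (hle n P hP)
  refine ⟨fun m n hmn => hρle n _ (hρ0 m) fun P hP => ?_, ?_⟩
  · have := hprob P hP
    exact (integral_mono ((hbm n).integrable P) ((hbm m).integrable P)
      fun ω => hanti ω hmn).trans (hle m P hP)
  · have hunif := tendstoUniformlyOn_integral_of_isCompact_densities P₀ 𝔓 hprob hac D hD hcpt ξ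
      hbm hanti hto0
    rw [Metric.tendstoUniformlyOn_iff] at hunif
    rw [Metric.tendsto_nhds]
    intro ε hε
    filter_upwards [hunif (ε / 2) (half_pos hε)] with n hn
    rw [Real.dist_0_eq_abs, abs_of_nonneg (hρ0 n)]
    refine (hρle n (ε / 2) (half_pos hε).le fun P hP => ?_).trans_lt (half_lt_self hε)
    have h := hn P hP
    rw [dist_comm, Real.dist_0_eq_abs] at h
    exact (le_abs_self _).trans h.le
end
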